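/- (Cluster identification.) Let V be a finite set with n = |V| ≥ 1, let κ : ℝ^d × ℝ^d → ℝ be L-Lipschitz in each argument with L ≥ 0, and let client k have embedding map h_k : V → ℝ^d. Suppose that for every client m in the same cluster as k the average embedding divergence satisfies (1/n) Σ_{i∈V} ‖h_k(i) − h_m(i)‖ ≤ ε_C, and that for every client n in a different cluster the cross-cluster separation ‖Ã_k − Ã_n‖_F > 2 L n² ε_C holds. Then for every same-cluster client m and every cross-cluster client n, ‖Ã_k − Ã_m‖_F < ‖Ã_k − Ã_n‖_F; in particular, the client whose reconstructed adjacency matrix is closest to that of k in Frobenius norm belongs to the same cluster as k. -/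

import Mathlib

/-- The `ℓ²` norm of a finite real family is at most its `ℓ¹` norm. -/
theorem sqrt_sum_sq_le_sum_abs {α : Type*} (s : Finset α) (f : α → ℝ) :
    Real.sqrt (∑ a ∈ s, f a ^ 2) ≤ ∑ a ∈ s, |f a| := by
  refine Real.sqrt_le_iff.mpr ⟨Finset.sum_nonneg fun _ _ => abs_nonneg _, ?_⟩
  simpa only [sq_abs] using Finset.sum_sq_le_sq_sum_of_nonneg (s := s) (f := fun a => |f a|)
    fun _ _ => abs_nonneg _

/-- Two reconstructions through a kernel that is `L`-Lipschitz in each argument differ in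
Frobenius norm by at most `2 L |V|` times the total divergence of the embeddings. -/
theorem frobenius_kernel_sub_le {V E : Type*} [Fintype V] [SeminormedAddCommGroup E]
    (κ : E → E → ℝ) (L : ℝ)
    (hκ₁ : ∀ a a' b : E, |κ a b - κ a' b| ≤ L * ‖a - a'‖)
    (hκ₂ : ∀ a b b' : E, |κ a b - κ a b'| ≤ L * ‖b - b'‖) (f g : V → E) :
    Real.sqrt (∑ i : V, ∑ j : V, (κ (f i) (f j) - κ (g i) (g j)) ^ 2)
      ≤ 2 * L * (Fintype.card V : ℝ) * ∑ i : V, ‖f i - g i‖ := by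
  have entry (i j : V) :
      |κ (f i) (f j) - κ (g i) (g j)| ≤ L * ‖f i - g i‖ + L * ‖f j - g j‖ :=
    (abs_sub_le _ (κ (g i) (f j)) _).trans (add_le_add (hκ₁ _ _ _) (hκ₂ _ _ _))
  calc Real.sqrt (∑ i : V, ∑ j : V, (κ (f i) (f j) - κ (g i) (g j)) ^ 2)
      ≤ ∑ i : V, ∑ j : V, |κ (f i) (f j) - κ (g i) (g j)| := by
        simpa only [Fintype.sum_prod_type] using sqrt_sum_sq_le_sum_abs Finset.univ
          fun p : V × V => κ (f p.1) (f p.2) - κ (g p.1) (g p.2)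
    _ ≤ ∑ i : V, ∑ j : V, (L * ‖f i - g i‖ + L * ‖f j - g j‖) :=
        Finset.sum_le_sum fun i _ => Finset.sum_le_sum fun j _ => entry i j
    _ = 2 * L * (Fintype.card V : ℝ) * ∑ i : V, ‖f i - g i‖ := by
        simp only [Finset.sum_add_distrib, Finset.sum_const, Finset.card_univ, nsmul_eq_mul,
          ← Finset.mul_sum]
        ring

/-- Cluster identification: if every same-cluster client `m` satisfies the
average-coherence bound with client `k`, and every cross-cluster client `n` satisfies the
separation `‖Ã_k − Ã_n‖_F > 2 L n² ε_C`, then every same-cluster reconstruction is strictly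
closer to `k`'s than every cross-cluster one; in particular any client minimizing the
Frobenius distance to `k`'s reconstruction lies in `k`'s cluster. -/
theorem cluster_identification {V ι C : Type*} [Fintype V] (d : ℕ)
    (h : ι → V → EuclideanSpace ℝ (Fin d)) (cluster : ι → C) (k : ι)
    (κ : EuclideanSpace ℝ (Fin d) → EuclideanSpace ℝ (Fin d) → ℝ)
    (L εC : ℝ) (hL : 0 ≤ L) (hε : 0 ≤ εC)
    (hcard : 1 ≤ Fintype.card V)
    (hκ₁ : ∀ a a' b : EuclideanSpace ℝ (Fin d), |κ a b - κ a' b| ≤ L * ‖a - a'‖)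
    (hκ₂ : ∀ a b b' : EuclideanSpace ℝ (Fin d), |κ a b - κ a b'| ≤ L * ‖b - b'‖)
    (hcoh : ∀ m : ι, cluster m = cluster k →
      (1 / (Fintype.card V : ℝ)) * ∑ i : V, ‖h k i - h m i‖ ≤ εC)
    (hsep : ∀ n : ι, cluster n ≠ cluster k →
      2 * L * (Fintype.card V : ℝ) ^ 2 * εC
        < Real.sqrt (∑ i : V, ∑ j : V, (κ (h k i) (h k j) - κ (h n i) (h n j)) ^ 2)) :
    (∀ m n : ι, cluster m = cluster k → cluster n ≠ cluster k →
      Real.sqrt (∑ i : V, ∑ j : V, (κ (h k i) (h k j) - κ (h m i) (h m j)) ^ 2)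
        < Real.sqrt (∑ i : V, ∑ j : V, (κ (h k i) (h k j) - κ (h n i) (h n j)) ^ 2)) ∧
    (∀ m : ι, (∀ p : ι,
        Real.sqrt (∑ i : V, ∑ j : V, (κ (h k i) (h k j) - κ (h m i) (h m j)) ^ 2)
          ≤ Real.sqrt (∑ i : V, ∑ j : V, (κ (h k i) (h k j) - κ (h p i) (h p j)) ^ 2)) →
      cluster m = cluster k) := by
  refine ⟨fun m n hm hn => lt_of_le_of_lt ?_ (hsep n hn), fun m hmin => ?_⟩
  · have hpos : (0 : ℝ) < Fintype.card V := by exact_mod_cast hcard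
    have hsum : ∑ i : V, ‖h k i - h m i‖ ≤ (Fintype.card V : ℝ) * εC := by
      have hmean := hcoh m hm
      rwa [one_div, inv_mul_le_iff₀ hpos] at hmean
    calc _ ≤ 2 * L * (Fintype.card V : ℝ) * ∑ i : V, ‖h k i - h m i‖ :=
          frobenius_kernel_sub_le κ L hκ₁ hκ₂ (h k) (h m)
      _ ≤ 2 * L * (Fintype.card V : ℝ) * ((Fintype.card V : ℝ) * εC) := by gcongr
      _ = 2 * L * (Fintype.card V : ℝ) ^ 2 * εC := by ring
  · by_contra hm
    have hle := (hsep m hm).trans_le (hmin k)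
    simp only [sub_self, ne_eq, OfNat.ofNat_ne_zero, not_false_eq_true, zero_pow,
      Finset.sum_const_zero, Real.sqrt_zero] at hle
    exact hle.not_ge (by positivity)
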